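/- arXiv:1901.02619 — 5 statements merged into one kernel-verified Lean document; each statement's English description precedes it below -/
import Mathlib

section
/- For every integer k ≥ 2 and every positive integer m, the polynomial p_m(x) = x^k − m·x^{k−1} − x^{k−2} − ⋯ − x − 1 has exactly one positive real root ϱ_m, and this root satisfies m < ϱ_m < m + 1. -/
/-- For `0 < x < y` and `n ≥ 1`, the ratio `(1 + x + ⋯ + x^(n−1)) / x^n` is larger than the same
ratio at `y`. -/
theorem geom_sum_mul_pow_lt {x y : ℝ} {n : ℕ} (hn : n ≠ 0) (hx : 0 < x) (hxy : x < y) :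
    (∑ j ∈ Finset.range n, y ^ j) * x ^ n < (∑ j ∈ Finset.range n, x ^ j) * y ^ n := by
  rw [Finset.sum_mul, Finset.sum_mul]
  refine Finset.sum_lt_sum_of_nonempty (Finset.nonempty_range_iff.mpr hn) fun j hj => ?_
  obtain ⟨d, rfl⟩ := Nat.exists_eq_add_of_lt (Finset.mem_range.mp hj)
  have hy : 0 < y := hx.trans hxy
  have hpow : x ^ (d + 1) < y ^ (d + 1) := pow_lt_pow_left₀ hxy hx.le d.succ_ne_zero
  calc y ^ j * x ^ (j + d + 1) = (x ^ j * y ^ j) * x ^ (d + 1) := by ring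
    _ < (x ^ j * y ^ j) * y ^ (d + 1) := by gcongr
    _ = x ^ j * y ^ (j + d + 1) := by ring

/-- Two positive roots of `x^(n+1) − a·x^n − x^(n−1) − ⋯ − 1` satisfy `y ≤ x`. -/
theorem le_of_positive_roots {a x y : ℝ} {n : ℕ} (hn : n ≠ 0) (hx : 0 < x) (hy : 0 < y)
    (hpx : x ^ (n + 1) - a * x ^ n - ∑ j ∈ Finset.range n, x ^ j = 0)
    (hpy : y ^ (n + 1) - a * y ^ n - ∑ j ∈ Finset.range n, y ^ j = 0) : y ≤ x := by
  by_contra! hxy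
  have h := geom_sum_mul_pow_lt hn hx hxy
  rw [← sub_eq_zero.mp hpx, ← sub_eq_zero.mp hpy] at h
  have hpos : 0 < x ^ n * y ^ n := by positivity
  have h' : (x ^ n * y ^ n) * y < (x ^ n * y ^ n) * x := by
    rw [pow_succ, pow_succ] at h
    linarith
  exact hxy.not_gt (lt_of_mul_lt_mul_left h' hpos.le)


/-- For every integer `k ≥ 2` and every positive integer `m`, the polynomial
`p_m(x) = x^k − m·x^(k−1) − x^(k−2) − ⋯ − x − 1` has exactly one positive real root `ϱ`,
and this root satisfies `m < ϱ < m + 1`. -/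
theorem unique_positive_root_metallic (k m : ℕ) (hk : 2 ≤ k) (hm : 1 ≤ m) :
    ∃ ϱ : ℝ, 0 < ϱ ∧
      (ϱ ^ k - m * ϱ ^ (k - 1) - ∑ j ∈ Finset.range (k - 1), ϱ ^ j = 0) ∧
      (m : ℝ) < ϱ ∧ ϱ < m + 1 ∧
      ∀ x : ℝ, 0 < x →
        x ^ k - m * x ^ (k - 1) - ∑ j ∈ Finset.range (k - 1), x ^ j = 0 → x = ϱ := by
  obtain ⟨n, rfl⟩ : ∃ n, k = n + 1 := ⟨k - 1, by omega⟩
  have hn : n ≠ 0 := by omega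
  simp only [Nat.add_sub_cancel]
  have hm' : (1 : ℝ) ≤ m := by exact_mod_cast hm
  set f : ℝ → ℝ := fun x => x ^ (n + 1) - m * x ^ n - ∑ j ∈ Finset.range n, x ^ j with hf
  have hcont : ContinuousOn f (Set.Icc (m : ℝ) (m + 1)) := by
    apply Continuous.continuousOn
    fun_prop
  have hleft : f m < 0 := by
    have hsum : 0 < ∑ j ∈ Finset.range n, (m : ℝ) ^ j :=
      Finset.sum_pos (fun j _ => by positivity) (Finset.nonempty_range_iff.mpr hn)
    simp only [hf, pow_succ']
    linarith
  have hright : 0 < f (m + 1) := by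
    have hgeom := geom_sum_mul ((m : ℝ) + 1) n
    have hsum : 0 ≤ ∑ j ∈ Finset.range n, ((m : ℝ) + 1) ^ j :=
      Finset.sum_nonneg fun j _ => by positivity
    simp only [hf, pow_succ']
    nlinarith
  obtain ⟨r, ⟨hr₁, hr₂⟩, hr⟩ := intermediate_value_Ioo (by linarith) hcont ⟨hleft, hright⟩
  have hr₀ : 0 < r := by linarith
  exact ⟨r, hr₀, hr, hr₁, hr₂, fun x hx hpx =>
    le_antisymm (le_of_positive_roots hn hr₀ hx hr hpx) (le_of_positive_roots hn hx hr₀ hpx hr)⟩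
end

section
/- For all integers k ≥ 2 and m ≥ 1, every complex root of the polynomial p_m(x) = x^k − m·x^{k−1} − x^{k−2} − ⋯ − x − 1 is a simple root; equivalently, p_m has k distinct complex roots. -/
open Polynomial in
/-- Multiplying by `X - 1` collapses the geometric sum. -/
theorem X_sub_one_mul_metallic (n : ℕ) (m : ℂ) :
    ((X - 1) * (X ^ (n + 2) - C m * X ^ (n + 1) - ∑ j ∈ Finset.range (n + 1), X ^ j) :
      Polynomial ℂ) = X ^ (n + 3) - C (m + 1) * X ^ (n + 2) + C (m - 1) * X ^ (n + 1) + 1 := by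
  have h := mul_geom_sum (X : Polynomial ℂ) (n + 1)
  simp only [C_add, C_sub, C_1]
  linear_combination -h

/-- A complex root of a real quadratic with positive discriminant and positive root sum and
nonnegative root product is a nonnegative real. -/
theorem exists_nonneg_real_of_quadratic {a b c : ℝ} (ha : 0 < a) (hb : 0 < b) (hc : 0 ≤ c)
    (hd : 4 * a * c < b ^ 2) {z : ℂ} (hz : a * z ^ 2 - b * z + c = 0) :
    ∃ r : ℝ, 0 ≤ r ∧ z = r := by
  have hre := congrArg Complex.re hz
  have him := congrArg Complex.im hz
  simp [pow_two] at hre him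
  have h0 : z.im = 0 := by
    by_contra h
    have h1 : 2 * a * z.re = b := mul_right_cancel₀ h (by linarith)
    have h2 : 0 < z.im ^ 2 := by positivity
    have h3 : 4 * a ^ 2 * z.im ^ 2 = 4 * a * c - b ^ 2 := by
      rw [← h1] at hre ⊢
      linear_combination -4 * a * hre
    have h4 : 0 < 4 * a ^ 2 * z.im ^ 2 := by positivity
    linarith
  refine ⟨z.re, ?_, Complex.ext rfl (by simpa using h0)⟩
  rw [h0] at hre
  by_contra! h
  nlinarith [mul_pos ha (mul_pos_of_neg_of_neg h h), mul_neg_of_pos_of_neg hb h]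

open Polynomial in
/-- A metallic polynomial and its derivative have no common nonnegative real root. -/
theorem metallic_derivative_ne_zero (n : ℕ) (m : ℂ) {r : ℝ} (hr : 0 ≤ r)
    (h0 : (X ^ (n + 2) - C m * X ^ (n + 1) - ∑ j ∈ Finset.range (n + 1), X ^ j :
      Polynomial ℂ).eval (r : ℂ) = 0) :
    (derivative (X ^ (n + 2) - C m * X ^ (n + 1) - ∑ j ∈ Finset.range (n + 1), X ^ j :
      Polynomial ℂ)).eval (r : ℂ) ≠ 0 := by
  intro h1
  have hS : (r : ℂ) * ∑ j ∈ Finset.range (n + 1), (j : ℂ) * (r : ℂ) ^ (j - 1) =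
      ∑ j ∈ Finset.range (n + 1), (j : ℂ) * (r : ℂ) ^ j := by
    rw [Finset.mul_sum]
    refine Finset.sum_congr rfl fun j _ => ?_
    cases j with
    | zero => simp
    | succ j => simp only [Nat.add_sub_cancel]; ring
  have hT : ∑ j ∈ Finset.range (n + 1), ((n : ℂ) + 1 - j) * (r : ℂ) ^ j =
      (n + 1) * ∑ j ∈ Finset.range (n + 1), (r : ℂ) ^ j -
        ∑ j ∈ Finset.range (n + 1), (j : ℂ) * (r : ℂ) ^ j := by
    simp only [sub_mul, Finset.sum_sub_distrib, Finset.mul_sum]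
  simp [derivative_X_pow, eval_finsetSum] at h0 h1
  have key : (r : ℂ) ^ (n + 2) +
      ∑ j ∈ Finset.range (n + 1), ((n : ℂ) + 1 - j) * (r : ℂ) ^ j = 0 := by
    rw [hT, ← hS]
    linear_combination (r : ℂ) * h1 - (n + 1) * h0
  have keyR : r ^ (n + 2) + ∑ j ∈ Finset.range (n + 1), ((n : ℝ) + 1 - j) * r ^ j = 0 := by
    exact_mod_cast key
  rw [Finset.sum_range_succ'] at keyR
  have hpos : 0 ≤ ∑ j ∈ Finset.range n, ((n : ℝ) + 1 - (j + 1 : ℕ)) * r ^ (j + 1) := by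
    refine Finset.sum_nonneg fun j hj => mul_nonneg ?_ (by positivity)
    have : (j : ℝ) ≤ n := by exact_mod_cast (Finset.mem_range.mp hj).le
    push_cast
    linarith
  have : 0 ≤ r ^ (n + 2) := by positivity
  have : (0 : ℝ) ≤ n := n.cast_nonneg
  simp only [Nat.cast_zero, pow_zero] at keyR
  linarith

open Polynomial in
/-- A metallic polynomial has no multiple complex root. -/
theorem metallic_derivative_eval_ne_zero (n m : ℕ) (hm : 1 ≤ m) {z : ℂ}
    (h0 : (X ^ (n + 2) - C (m : ℂ) * X ^ (n + 1) - ∑ j ∈ Finset.range (n + 1), X ^ j :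
      Polynomial ℂ).eval z = 0) :
    (derivative (X ^ (n + 2) - C (m : ℂ) * X ^ (n + 1) - ∑ j ∈ Finset.range (n + 1), X ^ j :
      Polynomial ℂ)).eval z ≠ 0 := by
  intro h1
  have hz : z ≠ 0 := by
    rintro rfl
    simp [eval_finsetSum, Finset.sum_range_succ'] at h0
  have hq := congrArg (fun p => (derivative p).eval z) (X_sub_one_mul_metallic n m)
  simp only [derivative_mul (f := (X - 1 : Polynomial ℂ)), eval_add, eval_mul, h0, h1, mul_zero, add_zero] at hq
  simp at hq
  have hquad : (((n + 3 : ℝ) : ℂ)) * z ^ 2 - ((((m : ℝ) + 1) * (n + 2) : ℝ) : ℂ) * z +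
      ((((m : ℝ) - 1) * (n + 1) : ℝ) : ℂ) = 0 := by
    refine (mul_eq_zero.mp (?_ : z ^ n * _ = 0)).resolve_left (pow_ne_zero n hz)
    push_cast
    linear_combination -hq
  have hm' : (1 : ℝ) ≤ m := by exact_mod_cast hm
  have hn : (0 : ℝ) ≤ n := n.cast_nonneg
  obtain ⟨r, hr, rfl⟩ := exists_nonneg_real_of_quadratic (by positivity) (by positivity)
    (mul_nonneg (sub_nonneg.mpr hm') (by positivity))
    (by nlinarith [mul_nonneg (sq_nonneg ((m : ℝ) - 1)) (sq_nonneg ((n : ℝ) + 2)),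
          sq_nonneg ((n : ℝ) + 2)]) hquad
  exact metallic_derivative_ne_zero n m hr h0 h1

open Polynomial in
/-- For all integers `k ≥ 2` and `m ≥ 1`, every complex root of
`p_m(x) = x^k − m·x^(k−1) − x^(k−2) − ⋯ − x − 1` is simple; equivalently,
`p_m` has `k` distinct complex roots. -/
theorem metallic_poly_roots_simple (k m : ℕ) (hk : 2 ≤ k) (hm : 1 ≤ m) :
    (X ^ k - C (m : ℂ) * X ^ (k - 1) - ∑ j ∈ Finset.range (k - 1), X ^ j :
        Polynomial ℂ).roots.Nodup ∧
    (X ^ k - C (m : ℂ) * X ^ (k - 1) - ∑ j ∈ Finset.range (k - 1), X ^ j :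
        Polynomial ℂ).roots.toFinset.card = k := by
  obtain ⟨n, rfl⟩ := Nat.exists_eq_add_of_le' hk
  simp only [show n + 2 - 1 = n + 1 from rfl]
  have hdeg : (X ^ (n + 2) - C (m : ℂ) * X ^ (n + 1) - ∑ j ∈ Finset.range (n + 1), X ^ j :
      Polynomial ℂ).natDegree = n + 2 := by
    have hlow : (C (m : ℂ) * X ^ (n + 1) + ∑ j ∈ Finset.range (n + 1), X ^ j :
        Polynomial ℂ).natDegree ≤ n + 1 := by
      refine natDegree_add_le_of_degree_le (natDegree_C_mul_X_pow_le _ _) ?_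
      refine natDegree_sum_le_of_forall_le _ _ fun j hj => ?_
      simpa using (Finset.mem_range.mp hj).le
    rw [sub_sub, natDegree_sub_eq_left_of_natDegree_lt] <;> rw [natDegree_X_pow]
    omega
  have hsimple := fun z => metallic_derivative_eval_ne_zero n m hm (z := z)
  generalize (X ^ (n + 2) - C (m : ℂ) * X ^ (n + 1) - ∑ j ∈ Finset.range (n + 1), X ^ j :
    Polynomial ℂ) = p at hdeg hsimple ⊢
  have hp : p ≠ 0 := by
    rintro rfl
    simp at hdeg
  have hnd : p.roots.Nodup := by
    refine Multiset.nodup_iff_count_le_one.mpr fun z => ?_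
    rw [count_roots]
    by_contra! h
    obtain ⟨h0, h1⟩ := (one_lt_rootMultiplicity_iff_isRoot hp).mp h
    exact hsimple z h0 h1
  refine ⟨hnd, ?_⟩
  rw [Multiset.toFinset_card_of_nodup hnd, IsAlgClosed.card_roots_eq_natDegree, hdeg]
end

section
/- Fix integers k ≥ 2 and m ≥ 1. Let (g^{(m)}_n)_{n≥0} be the sequence defined by g^{(m)}_0 = 0, g^{(m)}_1 = 1, and g^{(m)}_n = m·g^{(m)}_{n−1} + g^{(m)}_{n−2} + ⋯ + g^{(m)}_{n−k} for n ≥ 2, where terms with negative index are taken to be 0. Then the ratio g^{(m)}_{n+1} / g^{(m)}_n converges as n → ∞ to ϱ_m, the unique positive real root of the polynomial x^k − m·x^{k−1} − x^{k−2} − ⋯ − x − 1. -/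
/-- If a sequence is a weighted average of its previous `l + 1` terms, then an upper bound on
`l + 1` consecutive terms is an upper bound on all later terms. -/
theorem le_of_window_le {l : ℕ} {p u : ℕ → ℝ} (hp : ∀ j, 0 ≤ p j)
    (hsum : ∑ j ∈ Finset.range (l + 1), p j = 1)
    (hu : ∀ n, u (n + (l + 1)) = ∑ j ∈ Finset.range (l + 1), p j * u (n + j))
    {n : ℕ} {B : ℝ} (hB : ∀ j < l + 1, u (n + j) ≤ B) (i : ℕ) : u (n + i) ≤ B := by
  induction i using Nat.strong_induction_on with
  | _ i ih =>
    rcases lt_or_ge i (l + 1) with h | h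
    · exact hB i h
    · obtain ⟨t, rfl⟩ := Nat.exists_eq_add_of_le' h
      rw [← add_assoc, hu]
      calc ∑ j ∈ Finset.range (l + 1), p j * u (n + t + j)
          ≤ ∑ j ∈ Finset.range (l + 1), p j * B := by
            refine Finset.sum_le_sum fun j hj => mul_le_mul_of_nonneg_left ?_ (hp j)
            rw [add_assoc]
            exact ih _ (by have := Finset.mem_range.1 hj; omega)
        _ = B := by rw [← Finset.sum_mul, hsum, one_mul]

/-- If a sequence is a weighted average of its previous `l + 1` terms, then a lower bound on
`l + 1` consecutive terms is a lower bound on all later terms. -/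
theorem le_of_le_window {l : ℕ} {p u : ℕ → ℝ} (hp : ∀ j, 0 ≤ p j)
    (hsum : ∑ j ∈ Finset.range (l + 1), p j = 1)
    (hu : ∀ n, u (n + (l + 1)) = ∑ j ∈ Finset.range (l + 1), p j * u (n + j))
    {n : ℕ} {b : ℝ} (hb : ∀ j < l + 1, b ≤ u (n + j)) (i : ℕ) : b ≤ u (n + i) := by
  refine neg_le_neg_iff.1 (le_of_window_le (u := fun n => -u n) hp hsum (fun n => ?_)
    (fun j hj => neg_le_neg (hb j hj)) i)
  simp [hu]

/-- A small term pulls the following terms of an averaging sequence away from an upper bound. -/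
theorem le_sub_pow_mul_of_le {l : ℕ} {p u : ℕ → ℝ} (hp : ∀ j, 0 ≤ p j)
    (hsum : ∑ j ∈ Finset.range (l + 1), p j = 1)
    (hu : ∀ n, u (n + (l + 1)) = ∑ j ∈ Finset.range (l + 1), p j * u (n + j))
    {N : ℕ} {B a : ℝ} (hB : ∀ n ≥ N, u n ≤ B) {i : ℕ} (hi : N + l ≤ i) (ha : u i ≤ a) (s : ℕ) :
    u (i + s) ≤ B - p l ^ s * (B - a) := by
  induction s with
  | zero => simpa using ha
  | succ s ih =>
    obtain ⟨t, ht⟩ := Nat.exists_eq_add_of_le' (show l ≤ i + s by omega)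
    have hpl : ∑ j ∈ Finset.range l, p j = 1 - p l := by
      rw [← hsum, Finset.sum_range_succ]; ring
    rw [← add_assoc, ht, add_assoc, hu, Finset.sum_range_succ, ← ht]
    have h1 : ∑ j ∈ Finset.range l, p j * u (t + j) ≤ (1 - p l) * B := by
      rw [← hpl, Finset.sum_mul]
      exact Finset.sum_le_sum fun j _ =>
        mul_le_mul_of_nonneg_left (hB _ (by omega)) (hp j)
    have h2 := mul_le_mul_of_nonneg_left ih (hp l)
    rw [pow_succ]
    linarith

open Filter in
/-- A sequence each of whose terms is a fixed weighted average of the previous `l + 1` terms, with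
positive weight on the immediately preceding one, converges. -/
theorem exists_tendsto_of_eq_average {l : ℕ} {p u : ℕ → ℝ} (hp : ∀ j, 0 ≤ p j) (hpl : 0 < p l)
    (hsum : ∑ j ∈ Finset.range (l + 1), p j = 1)
    (hu : ∀ n, u (n + (l + 1)) = ∑ j ∈ Finset.range (l + 1), p j * u (n + j)) :
    ∃ L, Tendsto u atTop (nhds L) := by
  have hne : (Finset.range (l + 1)).Nonempty := ⟨0, by simp⟩
  obtain ⟨x, -, hx⟩ := Finset.exists_max_image (Finset.range (l + 1)) u hne
  obtain ⟨y, -, hy⟩ := Finset.exists_min_image (Finset.range (l + 1)) u hne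
  have hub : ∀ i, u i ≤ u x := fun i => by
    simpa using le_of_window_le (n := 0) hp hsum hu
      (fun j hj => by simpa using hx j (Finset.mem_range.2 hj)) i
  have hlb : ∀ i, u y ≤ u i := fun i => by
    simpa using le_of_le_window (n := 0) hp hsum hu
      (fun j hj => by simpa using hy j (Finset.mem_range.2 hj)) i
  have hbdd : IsBoundedUnder (· ≤ ·) atTop u := isBoundedUnder_of ⟨_, hub⟩
  have hbdd' : IsBoundedUnder (· ≥ ·) atTop u := isBoundedUnder_of ⟨_, hlb⟩
  have hpl1 : p l ≤ 1 := by
    rw [← hsum]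
    exact Finset.single_le_sum (fun j _ => hp j) (by simp)
  set S := limsup u atTop
  set I := liminf u atTop
  have hIS : I ≤ S := liminf_le_limsup hbdd hbdd'
  have key : p l ^ l * (S - I) ≤ 0 := by
    refine le_of_forall_pos_le_add fun ε hε => ?_
    obtain ⟨N, hN⟩ := eventually_atTop.1
      (eventually_lt_of_limsup_lt (show S < S + ε by linarith) hbdd)
    obtain ⟨i, hi, hui⟩ := frequently_atTop.1
      (frequently_lt_of_liminf_lt hbdd.isCoboundedUnder_flip (show I < I + ε by linarith)) (N + l)
    have hwin : ∀ j < l + 1, u (i + j) ≤ S + ε - p l ^ l * (S - I) := fun j hj => by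
      have h1 := le_sub_pow_mul_of_le hp hsum hu (fun n hn => (hN n hn).le) hi hui.le j
      have h2 : p l ^ l * (S - I) ≤ p l ^ j * (S - I) :=
        mul_le_mul_of_nonneg_right (pow_le_pow_of_le_one hpl.le hpl1 (by omega))
          (sub_nonneg.2 hIS)
      rw [add_sub_add_right_eq_sub] at h1
      linarith
    have hS : S ≤ S + ε - p l ^ l * (S - I) := by
      refine limsup_le_of_le hbdd'.isCoboundedUnder_flip (eventually_atTop.2 ⟨i, fun n hn => ?_⟩)
      obtain ⟨t, rfl⟩ := Nat.exists_eq_add_of_le hn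
      exact le_of_window_le hp hsum hu hwin t
    linarith
  have hSI : S ≤ I := by
    by_contra! h
    exact absurd key (not_le.2 (mul_pos (pow_pos hpl l) (sub_pos.2 h)))
  exact ⟨I, tendsto_of_le_liminf_of_limsup_le le_rfl hSI hbdd hbdd'⟩

open Filter in
/-- For `k ≥ 2` and `m ≥ 1`, the ratios of consecutive terms of the sequence defined by
`g 0 = 0`, `g 1 = 1` and `g n = m·g (n−1) + g (n−2) + ⋯ + g (n−k)` for `n ≥ 2`
(terms with negative index taken to be `0`) converge to the unique positive real root `ϱ`
of `x^k − m·x^(k−1) − x^(k−2) − ⋯ − x − 1`. -/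
theorem metallic_mean_ratio_limit (k m : ℕ) (hk : 2 ≤ k) (hm : 1 ≤ m) (g : ℕ → ℝ)
    (hg0 : g 0 = 0) (hg1 : g 1 = 1)
    (hgrec : ∀ n, 2 ≤ n → g n = m * g (n - 1) + ∑ j ∈ Finset.Icc 2 k, g (n - j))
    (ϱ : ℝ) (hϱ_pos : 0 < ϱ)
    (hϱ_root : ϱ ^ k - m * ϱ ^ (k - 1) - ∑ j ∈ Finset.range (k - 1), ϱ ^ j = 0)
    (hϱ_uniq : ∀ x : ℝ, 0 < x →
      x ^ k - m * x ^ (k - 1) - ∑ j ∈ Finset.range (k - 1), x ^ j = 0 → x = ϱ) :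
    Tendsto (fun n => g (n + 1) / g n) atTop (nhds ϱ) := by
  obtain ⟨l, rfl⟩ := Nat.exists_eq_add_of_le' (show 1 ≤ k by omega)
  have hm0 : (0 : ℝ) < m := by exact_mod_cast hm
  have hpos : ∀ n, 0 ≤ g n ∧ 0 < g (n + 1) := by
    intro n
    induction n using Nat.strong_induction_on with
    | _ n ih =>
      rcases n with _ | n
      · simp [hg0, hg1]
      · refine ⟨(ih n (by omega)).2.le, ?_⟩
        rw [hgrec _ (by omega)]
        refine add_pos_of_pos_of_nonneg (mul_pos hm0 (ih n (by omega)).2)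
          (Finset.sum_nonneg fun j hj => (ih _ ?_).1)
        have := Finset.mem_Icc.1 hj
        omega
  have hrec : ∀ n, g (n + (l + 1)) = m * g (n + l) + ∑ j ∈ Finset.range l, g (n + j) := by
    intro n
    rw [hgrec _ (by omega)]
    congr 1
    refine Finset.sum_nbij' (fun j => l + 1 - j) (fun j => l + 1 - j) ?_ ?_ ?_ ?_ ?_
    all_goals simp only [Finset.mem_Icc, Finset.mem_range]
    all_goals intro j hj
    any_goals omega
    congr 1
    omega
  have hroot : ϱ ^ (l + 1) = m * ϱ ^ l + ∑ j ∈ Finset.range l, ϱ ^ j := by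
    simp only [Nat.add_sub_cancel] at hϱ_root
    linarith
  set w : ℕ → ℝ := fun j => if j = l then (m : ℝ) else 1 with hw
  have hwpos : ∀ j, 0 < w j := fun j => by
    simp only [hw]; split_ifs <;> positivity
  have hwsum : ∀ f : ℕ → ℝ, ∑ j ∈ Finset.range (l + 1), w j * f j
      = m * f l + ∑ j ∈ Finset.range l, f j := fun f => by
    rw [Finset.sum_range_succ, add_comm]
    congr 1
    · simp [hw]
    · refine Finset.sum_congr rfl fun j hj => ?_
      simp [hw, (Finset.mem_range.1 hj).ne]
  set p : ℕ → ℝ := fun j => w j * ϱ ^ j / ϱ ^ (l + 1) with hpdef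
  set u : ℕ → ℝ := fun n => g n / ϱ ^ n with hudef
  have hp : ∀ j, 0 < p j := fun j => by
    have := hwpos j
    simp only [hpdef]; positivity
  have hsum : ∑ j ∈ Finset.range (l + 1), p j = 1 := by
    rw [← Finset.sum_div, hwsum, ← hroot, div_self (by positivity)]
  have hu : ∀ n, u (n + (l + 1)) = ∑ j ∈ Finset.range (l + 1), p j * u (n + j) := fun n => by
    simp only [hudef]
    rw [hrec, ← hwsum fun j => g (n + j), Finset.sum_div]
    refine Finset.sum_congr rfl fun j _ => ?_
    simp only [hpdef, pow_add]
    field_simp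
  obtain ⟨L, hL⟩ := exists_tendsto_of_eq_average (fun j => (hp j).le) (hp l) hsum hu
  have hLpos : 0 < L := by
    obtain ⟨y, -, hy⟩ := Finset.exists_min_image (Finset.range (l + 1)) (fun j => u (1 + j))
      ⟨0, by simp⟩
    have hupos : 0 < u (1 + y) := by
      rw [add_comm]
      exact div_pos (hpos y).2 (by positivity)
    refine hupos.trans_le (ge_of_tendsto hL (eventually_atTop.2 ⟨1, fun n hn => ?_⟩))
    obtain ⟨t, rfl⟩ := Nat.exists_eq_add_of_le hn
    exact le_of_le_window (fun j => (hp j).le) hsum hu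
      (fun j hj => hy j (Finset.mem_range.2 hj)) t
  have hlim := (((tendsto_add_atTop_iff_nat 1).2 hL).div hL hLpos.ne').const_mul ϱ
  rw [div_self hLpos.ne', mul_one] at hlim
  refine hlim.congr fun n => ?_
  simp only [hudef, Pi.div_apply, pow_succ]
  rcases eq_or_ne (g n) 0 with h | h
  · simp [h]
  · field_simp
end

section
/- For every positive integer m, the cubic polynomial x³ − m·x² − x − 1 has exactly one real root τ_m, and this root satisfies m < τ_m < m + 1. -/
/-- Every real root of `x³ − m·x² − x − 1` with `m > -1` is larger than `m`. -/
theorem lt_of_cubic_metallic_root {m x : ℝ} (hm : -1 < m)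
    (hx : x ^ 3 - m * x ^ 2 - x - 1 = 0) : m < x := by
  by_contra! hle
  have hnonneg : 0 ≤ x ^ 2 * (m - x) := mul_nonneg (sq_nonneg x) (sub_nonneg.2 hle)
  have hx1 : x ≤ -1 := by linarith
  have hsq : 1 ≤ x ^ 2 := by nlinarith
  have := mul_le_mul_of_nonneg_right hsq (sub_nonneg.2 hle)
  linarith

/-- For every positive integer `m`, the cubic `x³ − m·x² − x − 1` has exactly one real
root `τ`, and `m < τ < m + 1`. -/
theorem cubic_metallic_mean_exists_unique (m : ℕ) (hm : 1 ≤ m) :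
    ∃ τ : ℝ, (τ ^ 3 - m * τ ^ 2 - τ - 1 = 0) ∧ (m : ℝ) < τ ∧ τ < m + 1 ∧
      ∀ x : ℝ, x ^ 3 - m * x ^ 2 - x - 1 = 0 → x = τ := by
  have hm' : (1 : ℝ) ≤ m := by exact_mod_cast hm
  have hcont : ContinuousOn (fun x : ℝ => x ^ 3 - m * x ^ 2 - x - 1)
      (Set.Icc (m : ℝ) (m + 1)) := by fun_prop
  obtain ⟨τ, ⟨hmτ, hτm⟩, hτ⟩ := intermediate_value_Ioo (by linarith) hcont
    (show (0 : ℝ) ∈ Set.Ioo _ _ from ⟨by ring_nf; linarith, by ring_nf; nlinarith⟩)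
  refine ⟨τ, hτ, hmτ, hτm, fun x hx => ?_⟩
  have hmx := lt_of_cubic_metallic_root (by linarith) hx
  have hfactor : (x - τ) * (x * (x - m) + τ * (τ - m) + (x * τ - 1)) = 0 := by
    linear_combination hx - hτ
  have hpos : 0 < x * (x - m) + τ * (τ - m) + (x * τ - 1) := by
    have h₁ : 0 < x * (x - m) := mul_pos (by linarith) (by linarith)
    have h₂ : 0 < τ * (τ - m) := mul_pos (by linarith) (by linarith)
    have h₃ : 1 < x * τ := one_lt_mul_of_lt_of_le (by linarith) (by linarith)
    linarith
  exact sub_eq_zero.1 ((mul_eq_zero.1 hfactor).resolve_right hpos.ne')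
end

section
/- Fix a positive integer m and let (T^{(m)}_n)_{n≥0} be the sequence defined by T^{(m)}_0 = 0, T^{(m)}_1 = 1, T^{(m)}_2 = m, and T^{(m)}_n = m·T^{(m)}_{n−1} + T^{(m)}_{n−2} + T^{(m)}_{n−3} for n ≥ 3. Then T^{(m)}_{n+1} / T^{(m)}_n converges as n → ∞ to τ_m, the unique real root of x³ − m·x² − x − 1. -/
/-- A real root of `x³ − m·x² − x − 1` with `m ≥ 1` is greater than `1`. -/
theorem one_lt_of_cubic_metallic_root {m τ : ℝ} (hm : 1 ≤ m)
    (hτ : τ ^ 3 - m * τ ^ 2 - τ - 1 = 0) : 1 < τ := by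
  by_contra! h
  have h1 : τ ≤ -1 := by
    nlinarith [mul_nonneg (sq_nonneg τ) (sub_nonneg.2 (h.trans hm))]
  nlinarith [mul_nonneg (neg_nonneg.2 (h1.trans (by norm_num : (-1 : ℝ) ≤ 0)))
    (by nlinarith : (0 : ℝ) ≤ τ ^ 2 - 1), mul_nonneg (zero_le_one.trans hm) (sq_nonneg τ)]

/-- The quadratic form `y² + c·x·y + b·x²` evaluated on consecutive terms of a solution of
`D (n+2) = −c·D (n+1) − b·D n` is geometric with ratio `b`. -/
theorem quadratic_form_geometric {b c : ℝ} {D : ℕ → ℝ}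
    (hD : ∀ n, D (n + 2) = -c * D (n + 1) - b * D n) (n : ℕ) :
    D (n + 1) ^ 2 + c * D n * D (n + 1) + b * D n ^ 2 =
      (D 1 ^ 2 + c * D 0 * D 1 + b * D 0 ^ 2) * b ^ n := by
  induction n with
  | zero => simp
  | succ n ih =>
    rw [pow_succ b, ← mul_assoc, ← ih, hD n]
    ring


open Filter in
/-- For a positive integer `m`, the ratios of consecutive terms of the sequence defined
by `T 0 = 0`, `T 1 = 1`, `T 2 = m` and `T n = m·T (n−1) + T (n−2) + T (n−3)` for `n ≥ 3`
converge to the unique real root `τ` of `x³ − m·x² − x − 1`. -/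
theorem cubic_metallic_ratio_limit (m : ℕ) (hm : 1 ≤ m) (T : ℕ → ℝ)
    (hT0 : T 0 = 0) (hT1 : T 1 = 1) (hT2 : T 2 = m)
    (hTrec : ∀ n, 3 ≤ n → T n = m * T (n - 1) + T (n - 2) + T (n - 3))
    (τ : ℝ) (hτ_root : τ ^ 3 - m * τ ^ 2 - τ - 1 = 0)
    (hτ_uniq : ∀ x : ℝ, x ^ 3 - m * x ^ 2 - x - 1 = 0 → x = τ) :
    Tendsto (fun n => T (n + 1) / T n) atTop (nhds τ) := by
  have hm1 : (1 : ℝ) ≤ m := by exact_mod_cast hm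
  have hτ1 : 1 < τ := one_lt_of_cubic_metallic_root hm1 hτ_root
  have hrec : ∀ n, T (n + 3) = m * T (n + 2) + T (n + 1) + T n := fun n =>
    hTrec (n + 3) (by omega)
  have hpos : ∀ n, 0 ≤ T n ∧ 1 ≤ T (n + 1) ∧ 1 ≤ T (n + 2) := by
    intro n
    induction n with
    | zero => simp [hT0, hT1, hT2, hm]
    | succ n ih =>
      obtain ⟨h0, h1, h2⟩ := ih
      refine ⟨by linarith, h2, ?_⟩
      rw [hrec n]
      nlinarith
  obtain ⟨b, hb⟩ : ∃ b, b = τ ^ 2 - m * τ - 1 := ⟨_, rfl⟩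
  obtain ⟨c, hc⟩ : ∃ c, c = τ - m := ⟨_, rfl⟩
  have hbτ : b * τ = 1 := by rw [hb]; linear_combination hτ_root
  have hb0 : 0 < b := pos_of_mul_pos_left (hbτ ▸ one_pos) (by linarith)
  have hb1 : b < 1 := by nlinarith
  have hcb : c = b + b ^ 2 := by
    rw [hc]
    linear_combination (-(τ - m)) * hbτ - b * hb
  have hk : 0 < b - c ^ 2 / 4 := by
    have h4 : (1 + b) ^ 2 < 4 := by nlinarith
    have h5 : b * (1 + b) ^ 2 < 4 := by nlinarith
    rw [hcb]
    nlinarith [mul_pos hb0 (sub_pos.2 h5)]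
  have hQ := quadratic_form_geometric (b := b) (c := c) (D := fun n => T (n + 1) - τ * T n)
    (fun n => by
      simp only [hrec n, hc]
      linear_combination T (n + 1) * hb - T n * hbτ)
  have hbound : ∀ n, (T (n + 2) / T (n + 1) - τ) ^ 2 ≤ b ^ (n + 2) / (b - c ^ 2 / 4) := by
    intro n
    have hT : 1 ≤ T (n + 1) := (hpos n).2.1
    have hQn : (T (n + 2) - τ * T (n + 1)) ^ 2 * (b - c ^ 2 / 4) ≤ b ^ (n + 2) := by
      have h := hQ (n + 1)
      have hQ0 : (T (1 + 1) - τ * T 1) ^ 2 + c * (T (0 + 1) - τ * T 0) * (T (1 + 1) - τ * T 1) +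
          b * (T (0 + 1) - τ * T 0) ^ 2 = b := by
        simp only [zero_add, one_add_one_eq_two, hT0, hT1, hT2, hc]
        ring
      rw [hQ0, ← pow_succ'] at h
      rw [← h]
      nlinarith [sq_nonneg ((T (n + 3) - τ * T (n + 2)) + c / 2 * (T (n + 2) - τ * T (n + 1)))]
    have hdiv : T (n + 2) / T (n + 1) - τ = (T (n + 2) - τ * T (n + 1)) / T (n + 1) := by
      field_simp
    rw [hdiv, div_pow]
    exact (div_le_self (sq_nonneg _) (one_le_pow₀ hT)).trans ((le_div_iff₀ hk).2 hQn)
  have hlim : Tendsto (fun n => b ^ (n + 2) / (b - c ^ 2 / 4)) atTop (nhds 0) := by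
    simpa using ((tendsto_add_atTop_iff_nat 2).2
      (tendsto_pow_atTop_nhds_zero_of_lt_one hb0.le hb1)).div_const (b - c ^ 2 / 4)
  have hsq := (squeeze_zero (fun _ => sq_nonneg _) hbound hlim).sqrt
  simp only [Real.sqrt_sq_eq_abs, Real.sqrt_zero] at hsq
  exact (tendsto_add_atTop_iff_nat 1).1
    (tendsto_sub_nhds_zero_iff.1 ((tendsto_zero_iff_abs_tendsto_zero _).2 hsq))
end
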